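/- arXiv:math/0701251 — 3 statements merged into one kernel-verified Lean document; each statement's English description precedes it below -/
import Mathlib

section
/- For every n ≥ 0, the coefficient a_n of q^n in the expansion of ∏_{m=1}^∞ (1 - q^m) satisfies: a_n = (-1)^k if there exists an integer k with 24n + 1 = (6k + 1)^2 (such a k is unique), and a_n = 0 if no such integer k exists. -/
theorem pentagonal_neg_eq_iff (n : ℕ) (k : ℤ) :
    pentagonal (-k) = n ↔ (24 * n + 1 : ℤ) = (6 * k + 1) ^ 2 := by
  have h := two_mul_natCast_pentagonal_neg k
  rw [← Nat.cast_inj (R := ℤ)]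
  constructor
  · intro hk
    rw [← hk]
    linear_combination 12 * h
  · intro hk
    linarith

theorem eq_coeff_pentagonalSeries (a : ℕ → ℤ)
    (ha : ∀ n N : ℕ, n ≤ N →
      a n = ((∏ m ∈ Finset.Icc 1 N, ((1 : Polynomial ℤ) - Polynomial.X ^ m)).coeff n)) (n : ℕ) :
    a n = (PowerSeries.pentagonalSeries ℤ).coeff n := by
  obtain ⟨N, hN, hn⟩ := ((Filter.tendsto_finset_range.eventually
    (PowerSeries.coeff_prod_one_sub_X_pow_eventually_eq ℤ n)).and
      (Filter.eventually_ge_atTop n)).exists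
  rw [ha n N hn, ← hN, ← Polynomial.coeff_coe, ← Polynomial.coeToPowerSeries.ringHom_apply,
    map_prod, Finset.range_eq_Ico,
    Finset.prod_Ico_add' (fun m ↦ (1 - PowerSeries.X ^ m : PowerSeries ℤ))]
  simp [Finset.Ico_add_one_right_eq_Icc]

/-- Euler's pentagonal-number theorem: the coefficient `a n` of `q^n` in
`∏ (1 - q^m)` equals `(-1)^k` if `24n + 1 = (6k+1)^2` for some integer `k`,
and `0` otherwise. -/
theorem stmt_0 (a : ℕ → ℤ)
    (ha : ∀ n N : ℕ, n ≤ N →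
      a n = ((∏ m ∈ Finset.Icc 1 N, ((1 : Polynomial ℤ) - Polynomial.X ^ m)).coeff n)) :
    ∀ n : ℕ,
      (∀ k : ℤ, (24 * n + 1 : ℤ) = (6 * k + 1) ^ 2 →
        a n = (((-1 : ℤˣ) ^ k : ℤˣ) : ℤ)) ∧
      ((¬ ∃ k : ℤ, (24 * n + 1 : ℤ) = (6 * k + 1) ^ 2) → a n = 0) := by
  intro n
  rw [eq_coeff_pentagonalSeries a ha n]
  constructor
  · intro k hk
    rw [← (pentagonal_neg_eq_iff n k).mpr hk, PowerSeries.coeff_pentagonalSeries_pentagonal,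
      Int.negOnePow_neg]
    simp [Int.negOnePow_def]
  · intro h
    apply PowerSeries.coeff_pentagonalSeries_eq_zero
    rintro ⟨k, hk⟩
    exact h ⟨-k, (pentagonal_neg_eq_iff n (-k)).mp (by rwa [neg_neg])⟩
end

section
/- Let a_n be the coefficient of q^n in ∏_{m=1}^∞ (1 - q^m). Let f : ℕ → ℤ be the multiplicative arithmetic function determined on prime powers p^r (r ≥ 1) by: f(p^r) = 1 if p ≡ 1 or 11 (mod 12) and r is even; f(p^r) = (-1)^{r/2} if p ≡ 5 or 7 (mod 12) and r is even; and f(p^r) = 0 otherwise. Then a_n = f(24n + 1) for all n ≥ 0. -/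
/-- The quadratic character modulo 12, as a multiplicative map on the natural numbers. -/
def chiTwelve : ℕ →* ℤ where
  toFun m := if m % 12 = 1 ∨ m % 12 = 11 then 1 else if m % 12 = 5 ∨ m % 12 = 7 then -1 else 0
  map_one' := by simp
  map_mul' m n := by
    rw [Nat.mul_mod]
    have hm : m % 12 < 12 := Nat.mod_lt _ (by norm_num)
    have hn : n % 12 < 12 := Nat.mod_lt _ (by norm_num)
    generalize m % 12 = u at *
    generalize n % 12 = v at *
    interval_cases u <;> interval_cases v <;> rfl

theorem chiTwelve_apply (m : ℕ) : chiTwelve m =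
    if m % 12 = 1 ∨ m % 12 = 11 then 1 else if m % 12 = 5 ∨ m % 12 = 7 then -1 else 0 := rfl

theorem chiTwelve_natAbs_six_mul_sub_one (k : ℤ) :
    chiTwelve (6 * k - 1).natAbs = Int.negOnePow k := by
  rw [chiTwelve_apply]
  rcases Int.even_or_odd k with hk | hk
  · rw [Int.negOnePow_even k hk, if_pos (by grind)]
    rfl
  · rw [Int.negOnePow_odd k hk, if_neg (by grind), if_pos (by grind)]
    rfl

theorem pentagonal_eq_iff_sq_eq (k : ℤ) (n : ℕ) :
    pentagonal k = n ↔ (6 * k - 1).natAbs ^ 2 = 24 * n + 1 := by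
  have h := two_mul_natCast_pentagonal k
  zify
  rw [sq_abs]
  constructor <;> intro h' <;> linarith

theorem exists_pentagonal_eq_of_isSquare {n : ℕ} (h : IsSquare (24 * n + 1)) :
    ∃ k, pentagonal k = n := by
  obtain ⟨m, hm⟩ := h
  have hmod : m * m % 6 = 1 := by omega
  have h6 : m % 6 = 1 ∨ m % 6 = 5 := by
    rw [Nat.mul_mod] at hmod
    have : m % 6 < 6 := Nat.mod_lt _ (by norm_num)
    generalize m % 6 = u at *
    interval_cases u <;> simp_all
  obtain ⟨k, hk⟩ : ∃ k : ℤ, (6 * k - 1).natAbs = m := by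
    rcases h6 with h6 | h6
    · exact ⟨-(m / 6 : ℕ), by omega⟩
    · exact ⟨(m / 6 : ℕ) + 1, by omega⟩
  exact ⟨k, (pentagonal_eq_iff_sq_eq k n).2 (by rw [hk, hm, sq])⟩

theorem exists_odd_factorization_of_not_isSquare {N : ℕ} (h0 : N ≠ 0) (hN : ¬IsSquare N) :
    ∃ p : ℕ, p.Prime ∧ Odd (N.factorization p) := by
  by_contra! h
  refine hN ⟨N.factorization.prod fun p r ↦ p ^ (r / 2), ?_⟩
  conv_lhs => rw [← Nat.prod_factorization_pow_eq_self h0]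
  rw [← Finsupp.prod_mul]
  refine Finset.prod_congr rfl fun p hp ↦ ?_
  have := Nat.not_odd_iff_even.1 (h p (Nat.prime_of_mem_primeFactors hp))
  beta_reduce
  rw [← pow_add]
  congr 1
  grind

theorem exists_coeff_prod_one_sub_X_pow_eq (n : ℕ) : ∃ N, n ≤ N ∧
    (∏ m ∈ Finset.Icc 1 N, ((1 : Polynomial ℤ) - Polynomial.X ^ m)).coeff n =
      (PowerSeries.pentagonalSeries ℤ).coeff n := by
  have h := Filter.tendsto_finset_range.eventually
    (PowerSeries.coeff_prod_one_sub_X_pow_eventually_eq ℤ n)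
  obtain ⟨N, hN, hle⟩ := (h.and (Filter.eventually_ge_atTop n)).exists
  refine ⟨N, hle, ?_⟩
  rw [← hN, ← Polynomial.coeff_coe, ← Polynomial.coeToPowerSeries.ringHom_apply, map_prod,
    ← Finset.Ico_add_one_right_eq_Icc, Finset.prod_Ico_eq_prod_range]
  simp [add_comm]

/-- With `a n` the coefficient of `q^n` in `∏ (1 - q^m)`, and `f` the
multiplicative function with the stated values on prime powers, we have
`a n = f (24 n + 1)` for all `n`. -/
theorem stmt_2 (a : ℕ → ℤ)
    (ha : ∀ n N : ℕ, n ≤ N →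
      a n = ((∏ m ∈ Finset.Icc 1 N, ((1 : Polynomial ℤ) - Polynomial.X ^ m)).coeff n))
    (f : ℕ → ℤ)
    (hf1 : f 1 = 1)
    (hfmul : ∀ m n : ℕ, Nat.Coprime m n → f (m * n) = f m * f n)
    (hfa : ∀ p r : ℕ, p.Prime → 1 ≤ r → (p % 12 = 1 ∨ p % 12 = 11) → Even r →
      f (p ^ r) = 1)
    (hfb : ∀ p r : ℕ, p.Prime → 1 ≤ r → (p % 12 = 5 ∨ p % 12 = 7) → Even r →
      f (p ^ r) = (-1) ^ (r / 2))
    (hf0 : ∀ p r : ℕ, p.Prime → 1 ≤ r →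
      ¬((p % 12 = 1 ∨ p % 12 = 5 ∨ p % 12 = 7 ∨ p % 12 = 11) ∧ Even r) →
      f (p ^ r) = 0) :
    ∀ n : ℕ, a n = f (24 * n + 1) := by
  have hsq : ∀ m : ℕ, m ≠ 0 → f (m ^ 2) = chiTwelve m := by
    intro m
    induction m using Nat.recOnPosPrimePosCoprime with
    | zero => simp
    | one => simp [hf1]
    | prime_pow p r hp hr =>
      intro _
      rw [← pow_mul, map_pow, chiTwelve_apply]
      split_ifs with h1 h2
      · rw [hfa p _ hp (by omega) h1 (by simp), one_pow]
      · rw [hfb p _ hp (by omega) h2 (by simp), Nat.mul_div_cancel _ two_pos]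
      · rw [hf0 p _ hp (by omega) (by tauto), zero_pow hr.ne']
    | coprime u v hu hv huv ihu ihv =>
      intro _
      rw [mul_pow, hfmul _ _ (huv.pow 2 2), ihu (by omega), ihv (by omega), map_mul]
  intro n
  obtain ⟨N, hN, hcoeff⟩ := exists_coeff_prod_one_sub_X_pow_eq n
  rw [ha n N hN, hcoeff]
  by_cases hn : ∃ k, pentagonal k = n
  · obtain ⟨k, rfl⟩ := hn
    rw [PowerSeries.coeff_pentagonalSeries_pentagonal, ← (pentagonal_eq_iff_sq_eq k _).1 rfl,
      hsq _ (by omega), chiTwelve_natAbs_six_mul_sub_one, Int.cast_id]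
  · rw [PowerSeries.coeff_pentagonalSeries_eq_zero ℤ hn]
    obtain ⟨p, hp, hodd⟩ := exists_odd_factorization_of_not_isSquare (Nat.succ_ne_zero (24 * n))
      (mt exists_pentagonal_eq_of_isSquare hn)
    rw [Nat.succ_eq_add_one] at hodd
    rw [← Nat.ordProj_mul_ordCompl_eq_self (24 * n + 1) p,
      hfmul _ _ ((Nat.coprime_ordCompl hp (by omega)).pow_left _),
      hf0 p _ hp hodd.pos (fun h ↦ Nat.not_even_iff_odd.2 hodd h.2), zero_mul]
end

section
/- Let a_n be the coefficient of q^n in ∏_{m=1}^∞ (1 - q^m)^2. Let f : ℕ → ℤ be the multiplicative arithmetic function determined on prime powers p^r (r ≥ 1) by: f(p^r) = 1 if p ≡ 7 or 11 (mod 12) and r is even; f(p^r) = (-1)^{r/2} if p ≡ 5 (mod 12) and r is even; f(p^r) = r + 1 if p ≡ 1 (mod 12) and (-3)^{(p-1)/4} ≡ 1 (mod p); f(p^r) = (-1)^r (r + 1) if p ≡ 1 (mod 12) and (-3)^{(p-1)/4} ≡ -1 (mod p); and f(p^r) = 0 otherwise. Then a_n = f(12n + 1) for all n ≥ 0. -/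
namespace GaussianInt

open Finset

local notation "ℤ[i]" => GaussianInt

/-- A Gaussian integer is primary if it is congruent to `1` modulo `2 + 2 * i`. -/
def IsPrimary (z : ℤ[i]) : Prop := z.im % 2 = 0 ∧ (z.re + z.im) % 4 = 1

lemma isPrimary_iff_zmod (z : ℤ[i]) :
    IsPrimary z ↔ 2 * (z.im : ZMod 4) = 0 ∧ (z.re : ZMod 4) + z.im = 1 := by
  have h1 : (2 * (z.im : ZMod 4) = 0) ↔ z.im % 2 = 0 := by
    rw [show (2 * (z.im : ZMod 4)) = ((2 * z.im : ℤ) : ZMod 4) by push_cast; ring,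
      ZMod.intCast_zmod_eq_zero_iff_dvd]
    omega
  have h2 : ((z.re : ZMod 4) + z.im = 1) ↔ (z.re + z.im) % 4 = 1 := by
    rw [show (z.re : ZMod 4) + z.im = ((z.re + z.im : ℤ) : ZMod 4) by push_cast; ring,
      show (1 : ZMod 4) = ((1 : ℤ) : ZMod 4) by simp, ZMod.intCast_eq_intCast_iff']
    rfl
  rw [h1, h2, IsPrimary]

lemma isPrimary_one : IsPrimary 1 := by simp [IsPrimary]

lemma IsPrimary.mul {z w : ℤ[i]} (hz : IsPrimary z) (hw : IsPrimary w) : IsPrimary (z * w) := by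
  rw [isPrimary_iff_zmod] at *
  simp only [Zsqrtd.re_mul, Zsqrtd.im_mul]
  push_cast
  generalize (z.re : ZMod 4) = a at *
  generalize (z.im : ZMod 4) = b at *
  generalize (w.re : ZMod 4) = c at *
  generalize (w.im : ZMod 4) = d at *
  revert a b c d
  decide

lemma IsPrimary.of_mul_left {z w : ℤ[i]} (hz : IsPrimary z) (hzw : IsPrimary (z * w)) :
    IsPrimary w := by
  rw [isPrimary_iff_zmod] at *
  simp only [Zsqrtd.re_mul, Zsqrtd.im_mul] at hzw
  push_cast at hzw
  generalize (z.re : ZMod 4) = a at *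
  generalize (z.im : ZMod 4) = b at *
  generalize (w.re : ZMod 4) = c at *
  generalize (w.im : ZMod 4) = d at *
  revert a b c d
  decide

lemma IsPrimary.pow {z : ℤ[i]} (hz : IsPrimary z) (n : ℕ) : IsPrimary (z ^ n) := by
  induction n with
  | zero => simpa using isPrimary_one
  | succ n ih => rw [pow_succ]; exact ih.mul hz

lemma IsPrimary.star {z : ℤ[i]} (hz : IsPrimary z) : IsPrimary (star z) := by
  unfold IsPrimary at *
  simp only [Zsqrtd.re_star, Zsqrtd.im_star]
  omega

lemma norm_eq_sq_add_sq (z : ℤ[i]) : z.norm = z.re ^ 2 + z.im ^ 2 := by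
  rw [Zsqrtd.norm_def]; ring

lemma IsPrimary.norm_odd {z : ℤ[i]} (hz : IsPrimary z) : Odd z.norm := by
  obtain ⟨h1, h2⟩ := hz
  rw [norm_eq_sq_add_sq, Int.odd_add, Int.odd_pow' two_ne_zero, Int.even_pow' two_ne_zero,
    Int.odd_iff, Int.even_iff]
  omega

lemma IsPrimary.eq_one_of_norm {z : ℤ[i]} (hz : IsPrimary z) (h : z.norm = 1) : z = 1 := by
  obtain ⟨h1, h2⟩ := hz
  rw [norm_eq_sq_add_sq] at h
  have hi : z.im = 0 := by
    have : z.im ^ 2 < 2 ^ 2 := by nlinarith [sq_nonneg z.re]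
    have := abs_lt_of_sq_lt_sq' this (by norm_num)
    omega
  have hr : z.re = 1 := by
    rw [hi] at h
    have : (z.re - 1) * (z.re + 1) = 0 := by linarith
    rcases mul_eq_zero.1 this with h' | h' <;> omega
  ext <;> simp [hi, hr]

/-- A primary divisor of a primary number with the same norm is equal to it. -/
lemma IsPrimary.eq_of_dvd {z w : ℤ[i]} (hz : IsPrimary z) (hw : IsPrimary w) (h : z ∣ w)
    (hn : z.norm = w.norm) : z = w := by
  obtain ⟨u, rfl⟩ := h
  have h0 : z.norm ≠ 0 := fun h ↦ by have := hz.norm_odd; rw [h] at this; simp at this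
  rw [Zsqrtd.norm_mul] at hn
  have hu : u.norm = 1 := by
    have : z.norm * (u.norm - 1) = 0 := by linarith
    rcases mul_eq_zero.1 this with h | h
    · exact absurd h h0
    · linarith
  rw [(hz.of_mul_left hw).eq_one_of_norm hu, mul_one]

/-- Every Gaussian integer of odd norm has a primary associate. -/
lemma exists_isUnit_isPrimary_mul {z : ℤ[i]} (hz : Odd z.norm) :
    ∃ u : ℤ[i], IsUnit u ∧ IsPrimary (z * u) := by
  rw [norm_eq_sq_add_sq, Int.odd_add, Int.odd_pow' two_ne_zero, Int.even_pow' two_ne_zero,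
    Int.odd_iff, Int.even_iff] at hz
  have hu : ∀ a b : ℤ, a * a + b * b = 1 → IsUnit (⟨a, b⟩ : ℤ[i]) := fun a b h ↦ by
    rw [Zsqrtd.isUnit_iff_norm_isUnit, Zsqrtd.norm_def]
    simp [h]
  obtain ⟨x, y⟩ := z
  have key : ∀ a b : ℤ, a * a + b * b = 1 → (x * b + y * a) % 2 = 0 →
      (x * a - y * b + (x * b + y * a)) % 4 = 1 →
      ∃ u : ℤ[i], IsUnit u ∧ IsPrimary (⟨x, y⟩ * u) := fun a b h h1 h2 ↦ by
    refine ⟨⟨a, b⟩, hu a b h, ?_⟩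
    simp only [IsPrimary, Zsqrtd.re_mul, Zsqrtd.im_mul]
    refine ⟨h1, ?_⟩
    convert h2 using 2
    ring
  dsimp only at hz
  by_cases hy : y % 2 = 0
  · by_cases h : (x + y) % 4 = 1
    · exact key 1 0 (by norm_num) (by omega) (by omega)
    · exact key (-1) 0 (by norm_num) (by omega) (by omega)
  · by_cases h : (x - y) % 4 = 1
    · exact key 0 1 (by norm_num) (by omega) (by omega)
    · exact key 0 (-1) (by norm_num) (by omega) (by omega)

lemma finite_setOf_isPrimary_norm_eq (n : ℕ) : {z : ℤ[i] | IsPrimary z ∧ z.norm = n}.Finite := by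
  refine Set.Finite.subset (s := (fun x : ℤ × ℤ ↦ (⟨x.1, x.2⟩ : ℤ[i])) ''
    (Set.Icc (-n : ℤ) n ×ˢ Set.Icc (-n : ℤ) n)) ?_ ?_
  · exact ((Set.finite_Icc _ _).prod (Set.finite_Icc _ _)).image _
  · rintro z ⟨-, hz⟩
    rw [norm_eq_sq_add_sq] at hz
    refine ⟨(z.re, z.im), ⟨⟨?_, ?_⟩, ?_, ?_⟩, rfl⟩ <;> dsimp only <;>
      nlinarith [sq_nonneg z.re, sq_nonneg z.im, Int.le_self_sq z.re, Int.le_self_sq (-z.re),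
        Int.le_self_sq z.im, Int.le_self_sq (-z.im)]

/-- The primary Gaussian integers of norm `n`. -/
noncomputable def primaryOfNorm (n : ℕ) : Finset ℤ[i] :=
  (finite_setOf_isPrimary_norm_eq n).toFinset

@[simp]
lemma mem_primaryOfNorm {n : ℕ} {z : ℤ[i]} :
    z ∈ primaryOfNorm n ↔ IsPrimary z ∧ z.norm = n := by
  simp [primaryOfNorm]

lemma primaryOfNorm_one : primaryOfNorm 1 = {1} := by
  ext z
  simp only [mem_primaryOfNorm, Nat.cast_one, mem_singleton]
  refine ⟨fun h ↦ h.1.eq_one_of_norm h.2, ?_⟩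
  rintro rfl
  exact ⟨isPrimary_one, by simp⟩

lemma dvd_natCast_of_norm_eq {z : ℤ[i]} {n : ℕ} (h : z.norm = n) : z ∣ (n : ℤ[i]) :=
  ⟨star z, by rw [← Zsqrtd.norm_eq_mul_conj, h]; simp⟩

lemma isCoprime_of_norm {z w : ℤ[i]} {m n : ℕ} (hz : z.norm = m) (hw : w.norm = n)
    (h : m.Coprime n) : IsCoprime z w := by
  have : IsCoprime (m : ℤ[i]) (n : ℤ[i]) := by
    simpa using (Nat.isCoprime_iff_coprime.2 h).map (Int.castRingHom ℤ[i])
  exact (this.of_isCoprime_of_dvd_left (dvd_natCast_of_norm_eq hz)).of_isCoprime_of_dvd_right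
    (dvd_natCast_of_norm_eq hw)

lemma exists_mul_of_norm_eq_mul {z : ℤ[i]} (hz : IsPrimary z) {m n : ℕ} (hmn : m.Coprime n)
    (h : z.norm = m * n) :
    ∃ x y : ℤ[i], IsPrimary x ∧ IsPrimary y ∧ x.norm = m ∧ y.norm = n ∧ x * y = z := by
  have hodd := hz.norm_odd
  have hm0 : (m : ℤ) ≠ 0 := by
    intro h0
    rw [h, h0] at hodd
    simp at hodd
  set d := EuclideanDomain.gcd z (m : ℤ[i]) with hd
  have hdz : d ∣ z := EuclideanDomain.gcd_dvd_left _ _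
  have hdm : d ∣ (m : ℤ[i]) := EuclideanDomain.gcd_dvd_right _ _
  have hdvd : ∀ {x y : ℤ[i]}, x ∣ y → x.norm ∣ y.norm := by
    rintro x _ ⟨y, rfl⟩
    rw [Zsqrtd.norm_mul]
    exact dvd_mul_right _ _
  have h1 : d.norm ∣ m := by
    have e1 : d.norm ∣ (m : ℤ) * n := h ▸ hdvd hdz
    have e2 : d.norm ∣ (m : ℤ) * m := by
      have := hdvd hdm
      rwa [Zsqrtd.norm_natCast] at this
    have := dvd_gcd e1 e2
    have hg : gcd (n : ℤ) (m : ℤ) = 1 := by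
      rw [← Int.coe_gcd, Int.gcd_natCast_natCast, hmn.symm.gcd_eq_one]
      rfl
    rwa [_root_.gcd_mul_left, hg, mul_one, dvd_normalize_iff] at this
  have h2 : (m : ℤ) ∣ d.norm := by
    rw [← Zsqrtd.intCast_dvd_intCast (d := -1), Zsqrtd.norm_eq_mul_conj]
    have hb := EuclideanDomain.gcd_eq_gcd_ab z (m : ℤ[i])
    rw [← hd] at hb
    have hzz : z * star z = (m : ℤ[i]) * n := by
      rw [← Zsqrtd.norm_eq_mul_conj, h]; simp
    rw [hb, star_add, star_mul, star_mul]
    generalize EuclideanDomain.gcdA z (m : ℤ[i]) = A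
    generalize EuclideanDomain.gcdB z (m : ℤ[i]) = B
    have hs : star (m : ℤ[i]) = m := by ext <;> simp
    rw [hs]
    refine ⟨n * A * star A + z * A * star B + B * (star A * star z) + m * B * star B, ?_⟩
    push_cast
    linear_combination A * star A * hzz
  have hdn : d.norm = m := Int.dvd_antisymm (norm_nonneg _) (by positivity) h1 h2
  obtain ⟨u, hu, hdu⟩ := exists_isUnit_isPrimary_mul (z := d) (by
    rw [hdn]; rw [h, Int.odd_mul] at hodd; exact hodd.1)
  obtain ⟨e, he⟩ := hdz
  obtain ⟨v, hv⟩ := hu.exists_right_inv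
  have hun : u.norm = 1 := (Zsqrtd.norm_eq_one_iff' (by norm_num) u).2 hu
  have hz' : d * u * (v * e) = z := by linear_combination d * e * hv - he
  refine ⟨d * u, v * e, hdu, hdu.of_mul_left (hz' ▸ hz), ?_, ?_, hz'⟩
  · rw [Zsqrtd.norm_mul, hdn, hun, mul_one]
  · have := congrArg Zsqrtd.norm hz'
    rw [Zsqrtd.norm_mul, Zsqrtd.norm_mul, hdn, hun, mul_one, h] at this
    exact mul_left_cancel₀ hm0 this

section Sum

variable {R : Type*} [CommSemiring R] (X : ℤ[i] →* R)

/-- The sum of a multiplicative function over the primary Gaussian integers of norm `n`. -/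
noncomputable def primarySum (n : ℕ) : R := ∑ z ∈ primaryOfNorm n, X z

lemma primarySum_one : primarySum X 1 = 1 := by
  simp [primarySum, primaryOfNorm_one]

lemma primarySum_mul {m n : ℕ} (h : m.Coprime n) :
    primarySum X (m * n) = primarySum X m * primarySum X n := by
  rw [primarySum, primarySum, primarySum, sum_mul_sum, ← sum_product']
  symm
  refine sum_bij (fun x _ ↦ x.1 * x.2) ?_ ?_ ?_ ?_
  · rintro ⟨x, y⟩ hxy
    simp only [mem_product, mem_primaryOfNorm] at hxy ⊢
    refine ⟨hxy.1.1.mul hxy.2.1, ?_⟩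
    rw [Zsqrtd.norm_mul, hxy.1.2, hxy.2.2]
    push_cast
    rfl
  · rintro ⟨x, y⟩ hxy ⟨x', y'⟩ hxy' heq
    simp only [mem_product, mem_primaryOfNorm] at hxy hxy' heq
    have hx : x = x' := by
      refine hxy.1.1.eq_of_dvd hxy'.1.1 ?_ (hxy.1.2.trans hxy'.1.2.symm)
      exact (isCoprime_of_norm hxy.1.2 hxy'.2.2 h).dvd_of_dvd_mul_right ⟨y, heq.symm⟩
    have hy : y = y' := by
      refine hxy.2.1.eq_of_dvd hxy'.2.1 ?_ (hxy.2.2.trans hxy'.2.2.symm)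
      exact (isCoprime_of_norm hxy.2.2 hxy'.1.2 h.symm).dvd_of_dvd_mul_left
        ⟨x, by rw [mul_comm y x, heq]⟩
    rw [hx, hy]
  · intro z hz
    simp only [mem_primaryOfNorm, Nat.cast_mul] at hz
    obtain ⟨x, y, hx, hy, hxn, hyn, hxy⟩ := exists_mul_of_norm_eq_mul hz.1 h hz.2
    exact ⟨(x, y), by simp [hx, hy, hxn, hyn], hxy⟩
  · intro x _
    exact (map_mul X _ _).symm

lemma primarySum_even {n : ℕ} (h : Even n) : primarySum X n = 0 := by
  refine sum_eq_zero fun z hz ↦ ?_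
  rw [mem_primaryOfNorm] at hz
  have := hz.1.norm_odd
  rw [hz.2, Int.odd_coe_nat] at this
  exact absurd h (Nat.not_even_iff_odd.2 this)

lemma primarySum_eq_zero_of_prime {p : ℕ} [Fact p.Prime] (hp : p % 4 = 3) :
    primarySum X p = 0 := by
  refine sum_eq_zero fun z hz ↦ ?_
  rw [mem_primaryOfNorm, norm_eq_sq_add_sq] at hz
  have : ∀ a b : ZMod 4, a ^ 2 + b ^ 2 ≠ (p : ZMod 4) := by
    rw [← ZMod.natCast_mod p 4, hp]; decide
  exact absurd (by exact_mod_cast congrArg (Int.cast : ℤ → ZMod 4) hz.2) (this z.re z.im)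

lemma primarySum_inert {p : ℕ} [hp' : Fact p.Prime] (hp : p % 4 = 3) (r : ℕ) :
    primarySum X (p ^ (r + 2)) = X (-p) * primarySum X (p ^ r) := by
  have hprime := prime_of_nat_prime_of_mod_four_eq_three p hp
  have hP : IsPrimary (-p : ℤ[i]) := by
    simp only [IsPrimary, Zsqrtd.im_neg, Zsqrtd.re_neg, Zsqrtd.im_natCast, Zsqrtd.re_natCast]
    omega
  have hpn : (-p : ℤ[i]).norm = p * p := by rw [Zsqrtd.norm_neg, Zsqrtd.norm_natCast]
  have hp0 : (p : ℤ) ≠ 0 := by exact_mod_cast hp'.1.ne_zero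
  rw [primarySum, primarySum, mul_sum]
  symm
  refine sum_bij (fun x _ ↦ -p * x) ?_ ?_ ?_ ?_
  · intro z hz
    rw [mem_primaryOfNorm] at hz ⊢
    refine ⟨hP.mul hz.1, ?_⟩
    rw [Zsqrtd.norm_mul, hpn, hz.2]
    push_cast
    ring
  · intro x _ y _ h
    exact mul_left_cancel₀ (neg_ne_zero.2 hprime.ne_zero) h
  · intro z hz
    rw [mem_primaryOfNorm] at hz
    have hdvd : (-p : ℤ[i]) ∣ z := by
      have h1 : (p : ℤ[i]) ∣ z * star z := by
        rw [← Zsqrtd.norm_eq_mul_conj, hz.2]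
        push_cast
        exact dvd_pow_self _ (by omega)
      rw [neg_dvd]
      rcases hprime.dvd_or_dvd h1 with h | ⟨w, hw⟩
      · exact h
      · exact ⟨star w, by rw [← star_star z, hw, star_mul, mul_comm]; simp⟩
    obtain ⟨w, rfl⟩ := hdvd
    refine ⟨w, ?_, rfl⟩
    rw [mem_primaryOfNorm]
    refine ⟨hP.of_mul_left hz.1, ?_⟩
    have := hz.2
    rw [Zsqrtd.norm_mul, hpn] at this
    push_cast at this ⊢
    exact mul_left_cancel₀ (mul_ne_zero hp0 hp0) (this.trans (by ring))
  · intro x _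
    exact (map_mul X _ _).symm

lemma prime_of_norm_prime {z : ℤ[i]} {p : ℕ} (hp : p.Prime) (hz : z.norm = p) : Prime z := by
  refine irreducible_iff_prime.1 ⟨fun hu ↦ ?_, fun a b hab ↦ ?_⟩
  · have := (Zsqrtd.norm_eq_one_iff' (by norm_num) z).2 hu
    rw [hz] at this
    exact hp.one_lt.ne' (by exact_mod_cast this)
  · rw [hab, Zsqrtd.norm_mul] at hz
    have h := congrArg Int.natAbs hz
    rw [Int.natAbs_mul, Int.natAbs_natCast] at h
    rw [← Zsqrtd.norm_eq_one_iff, ← Zsqrtd.norm_eq_one_iff]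
    rcases Nat.prime_mul_iff.1 (h ▸ hp) with h | h
    · exact Or.inr h.2
    · exact Or.inl h.2

lemma primarySum_split {p : ℕ} (hp : p.Prime) {π : ℤ[i]} (hπ : IsPrimary π) (hn : π.norm = p)
    (r : ℕ) :
    primarySum X (p ^ (r + 1)) = X π * primarySum X (p ^ r) + X (star π) ^ (r + 1) := by
  have hprime := prime_of_norm_prime hp hn
  have hn' : (star π).norm = p := by rw [Zsqrtd.norm_conj, hn]
  have hprime' := prime_of_norm_prime hp hn'
  have hnd : ¬ π ∣ star π := by
    intro h
    have h1 := hπ.eq_of_dvd hπ.star h (hn.trans hn'.symm)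
    have h2 := congrArg Zsqrtd.im h1
    rw [Zsqrtd.im_star] at h2
    have h3 : π.im = 0 := by omega
    rw [norm_eq_sq_add_sq, h3] at hn
    have : IsSquare (p : ℤ) := ⟨π.re, by rw [← hn]; ring⟩
    exact (Nat.prime_iff_prime_int.1 hp).irreducible.not_isSquare this
  have hcop : IsCoprime π (star π) := hprime.irreducible.coprime_iff_not_dvd.2 hnd
  have hsplit : primaryOfNorm (p ^ (r + 1)) = insert (star π ^ (r + 1))
      ((primaryOfNorm (p ^ r)).image (π * ·)) := by
    ext z
    simp only [mem_insert, mem_image, mem_primaryOfNorm]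
    constructor
    · rintro ⟨hz, hzn⟩
      by_cases hd : π ∣ z
      · obtain ⟨w, rfl⟩ := hd
        refine Or.inr ⟨w, ⟨hπ.of_mul_left hz, ?_⟩, rfl⟩
        rw [Zsqrtd.norm_mul, hn] at hzn
        push_cast at hzn ⊢
        exact mul_left_cancel₀ (by exact_mod_cast hp.ne_zero : (p : ℤ) ≠ 0) (hzn.trans (by ring))
      · left
        symm
        refine (hπ.star.pow _).eq_of_dvd hz ?_ ?_
        · have hc : IsCoprime z π := (hprime.irreducible.coprime_iff_not_dvd.2 hd).symm
          have h1 : π ^ (r + 1) ∣ z * star z := by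
            rw [← Zsqrtd.norm_eq_mul_conj, hzn]
            refine ⟨star π ^ (r + 1), ?_⟩
            rw [← mul_pow, ← Zsqrtd.norm_eq_mul_conj, hn]
            push_cast
            rfl
          obtain ⟨w, hw⟩ := hc.pow_right.symm.dvd_of_dvd_mul_left h1
          exact ⟨star w, by rw [← star_star z, hw, star_mul, star_pow, mul_comm]⟩
        · rw [hzn]
          have : (star π ^ (r + 1)).norm = (star π).norm ^ (r + 1) := map_pow Zsqrtd.normMonoidHom _ _
          rw [this, hn']
          push_cast
          rfl
    · rintro (rfl | ⟨w, ⟨hw, hwn⟩, rfl⟩)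
      · refine ⟨hπ.star.pow _, ?_⟩
        have : (star π ^ (r + 1)).norm = (star π).norm ^ (r + 1) := map_pow Zsqrtd.normMonoidHom _ _
        rw [this, hn']
        push_cast
        rfl
      · refine ⟨hπ.mul hw, ?_⟩
        rw [Zsqrtd.norm_mul, hn, hwn]
        push_cast
        ring
  rw [primarySum, hsplit, sum_insert, sum_image, primarySum, mul_sum, add_comm, map_pow]
  · simp only [map_mul]
  · intro x _ y _ h
    exact mul_left_cancel₀ hprime.ne_zero h
  · simp only [mem_image, not_exists, not_and]
    intro w _ h
    exact hnd (hprime.dvd_of_dvd_pow ⟨w, h.symm⟩)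

end Sum

/-- The fourth-order character of `ℤ[i] / 3` trivial on `±1` and taking the value `-i` at `1 + i`,
on coordinates. -/
def modThreeValue (x y : ZMod 3) : ℤ[i] :=
  if x = 0 then if y = 0 then 0 else -1
  else if y = 0 then 1 else if x = y then ⟨0, -1⟩ else ⟨0, 1⟩

/-- The fourth-order character of `ℤ[i]` modulo `3` that is trivial on `±1` and takes the
value `-i` at `1 + i`. -/
def modThreeChar : ℤ[i] →* ℤ[i] where
  toFun z := modThreeValue z.re z.im
  map_one' := by simp [modThreeValue]
  map_mul' z w := by
    simp only [Zsqrtd.re_mul, Zsqrtd.im_mul]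
    push_cast
    generalize (z.re : ZMod 3) = a
    generalize (z.im : ZMod 3) = b
    generalize (w.re : ZMod 3) = c
    generalize (w.im : ZMod 3) = d
    revert a b c d
    decide

lemma modThreeChar_apply (z : ℤ[i]) : modThreeChar z = modThreeValue z.re z.im := rfl

lemma modThreeChar_star (z : ℤ[i]) : modThreeChar (star z) = star (modThreeChar z) := by
  simp only [modThreeChar_apply, Zsqrtd.re_star, Zsqrtd.im_star]
  push_cast
  generalize (z.re : ZMod 3) = a
  generalize (z.im : ZMod 3) = b
  revert a b
  decide

lemma modThreeChar_eq_one {z : ℤ[i]} (h : z.re % 3 ≠ 0) (h' : z.im % 3 = 0) :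
    modThreeChar z = 1 := by
  have h1 : (z.re : ZMod 3) ≠ 0 := by rw [Ne, ZMod.intCast_zmod_eq_zero_iff_dvd]; omega
  have h2 : (z.im : ZMod 3) = 0 := by rw [ZMod.intCast_zmod_eq_zero_iff_dvd]; omega
  simp [modThreeChar_apply, modThreeValue, h1, h2]

lemma modThreeChar_eq_neg_one {z : ℤ[i]} (h : z.re % 3 = 0) (h' : z.im % 3 ≠ 0) :
    modThreeChar z = -1 := by
  have h1 : (z.re : ZMod 3) = 0 := by rw [ZMod.intCast_zmod_eq_zero_iff_dvd]; omega
  have h2 : (z.im : ZMod 3) ≠ 0 := by rw [Ne, ZMod.intCast_zmod_eq_zero_iff_dvd]; omega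
  simp [modThreeChar_apply, modThreeValue, h1, h2]

lemma modThreeChar_neg_natCast {p : ℕ} (h : p % 3 ≠ 0) : modThreeChar (-p : ℤ[i]) = 1 :=
  modThreeChar_eq_one (by simp only [Zsqrtd.re_neg, Zsqrtd.re_natCast]; omega) (by simp)

lemma modThreeChar_of_norm_mod_three_eq_two {z : ℤ[i]} (h : z.norm % 3 = 2) :
    modThreeChar z = ⟨0, -1⟩ ∨ modThreeChar z = ⟨0, 1⟩ := by
  have h2 : (z.norm : ZMod 3) = 2 := by
    rw [show (2 : ZMod 3) = ((2 : ℤ) : ZMod 3) by simp, ZMod.intCast_eq_intCast_iff']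
    exact h
  rw [norm_eq_sq_add_sq] at h2
  push_cast at h2
  rw [modThreeChar_apply]
  generalize (z.re : ZMod 3) = a at *
  generalize (z.im : ZMod 3) = b at *
  revert a b
  decide

lemma primarySum_pow_of_mod_twelve_eq_one {p : ℕ} (hp : p.Prime) {π : ℤ[i]} (hπ : IsPrimary π)
    (hn : π.norm = p) {ε : ℤ} (h : modThreeChar π = ε) (r : ℕ) :
    primarySum modThreeChar (p ^ r) = ((ε ^ r * (r + 1) : ℤ) : ℤ[i]) := by
  have hs : modThreeChar (star π) = ε := by
    rw [modThreeChar_star, h]; ext <;> simp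
  induction r with
  | zero => simp [primarySum_one]
  | succ r ih =>
    rw [primarySum_split _ hp hπ hn, ih, hs, h]
    push_cast
    ring

lemma exists_isPrimary_norm_eq {p : ℕ} [hp : Fact p.Prime] (h : p % 4 = 1) :
    ∃ π : ℤ[i], IsPrimary π ∧ π.norm = p := by
  obtain ⟨a, b, hab⟩ := Nat.Prime.sq_add_sq (p := p) (by omega)
  have hn : (⟨a, b⟩ : ℤ[i]).norm = p := by
    rw [norm_eq_sq_add_sq, ← hab]
    push_cast
    rfl
  obtain ⟨u, hu, hz⟩ := exists_isUnit_isPrimary_mul (z := ⟨a, b⟩) (by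
    rw [hn, Int.odd_coe_nat, Nat.odd_iff]; omega)
  refine ⟨_, hz, ?_⟩
  rw [Zsqrtd.norm_mul, hn, (Zsqrtd.norm_eq_one_iff' (by norm_num) u).2 hu, mul_one]

lemma primarySum_pow_of_mod_twelve_eq_five {p : ℕ} [hp : Fact p.Prime] (h : p % 12 = 5) (r : ℕ) :
    primarySum modThreeChar (p ^ r) = if Even r then (-1) ^ (r / 2) else 0 := by
  obtain ⟨π, hπ, hn⟩ := exists_isPrimary_norm_eq (p := p) (by omega)
  obtain ⟨c, hc, hc2⟩ : ∃ c : ℤ[i], c ^ 2 = -1 ∧ modThreeChar π = c ∧ modThreeChar (star π) = -c := by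
    rw [modThreeChar_star]
    rcases modThreeChar_of_norm_mod_three_eq_two (z := π) (by rw [hn]; omega) with h | h
    · exact ⟨⟨0, -1⟩, by decide, h, by rw [h]; decide⟩
    · exact ⟨⟨0, 1⟩, by decide, h, by rw [h]; decide⟩
  have hrec := primarySum_split modThreeChar hp.1 hπ hn
  rw [hc2.1, hc2.2] at hrec
  have key : ∀ k, primarySum modThreeChar (p ^ (2 * k)) = (-1) ^ k ∧
      primarySum modThreeChar (p ^ (2 * k + 1)) = 0 := by
    intro k
    have hodd : primarySum modThreeChar (p ^ (2 * k)) = (-1) ^ k →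
        primarySum modThreeChar (p ^ (2 * k + 1)) = 0 := fun h ↦ by
      rw [hrec, h, pow_succ, pow_mul, neg_sq, hc]
      ring
    suffices primarySum modThreeChar (p ^ (2 * k)) = (-1) ^ k from ⟨this, hodd this⟩
    induction k with
    | zero => simp [primarySum_one]
    | succ k ih =>
      have ih' : primarySum modThreeChar (p ^ (2 * k + 1)) = 0 := by
        rw [hrec, ih fun h ↦ by rw [hrec, h, pow_succ, pow_mul, neg_sq, hc]; ring, pow_succ,
          pow_mul, neg_sq, hc]
        ring
      rw [show 2 * (k + 1) = 2 * k + 1 + 1 by ring, hrec, ih', mul_zero, zero_add,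
        show 2 * k + 1 + 1 = 2 * (k + 1) by ring, pow_mul, neg_sq, hc]
  rcases Nat.even_or_odd' r with ⟨k, rfl | rfl⟩
  · rw [(key k).1, if_pos (by simp), Nat.mul_div_cancel_left _ two_pos]
  · rw [(key k).2, if_neg (by simp)]

lemma primarySum_pow_of_mod_four_eq_three {p : ℕ} [hp : Fact p.Prime] (h : p % 4 = 3)
    (h3 : p % 3 ≠ 0) (r : ℕ) :
    primarySum modThreeChar (p ^ r) = if Even r then 1 else 0 := by
  induction r using Nat.twoStepInduction with
  | zero => simp [primarySum_one]
  | one => simpa using primarySum_eq_zero_of_prime _ h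
  | more r ih _ =>
    rw [primarySum_inert _ h, ih, modThreeChar_neg_natCast h3, one_mul]
    simp [Nat.even_add]

lemma primarySum_three_pow {r : ℕ} (hr : r ≠ 0) : primarySum modThreeChar (3 ^ r) = 0 := by
  have : Fact (Nat.Prime 3) := ⟨Nat.prime_three⟩
  match r, hr with
  | 1, _ => simpa using primarySum_eq_zero_of_prime (p := 3) modThreeChar rfl
  | r + 2, _ =>
    rw [primarySum_inert _ rfl]
    have : modThreeChar (-(3 : ℕ) : ℤ[i]) = 0 := by decide
    rw [this, zero_mul]

lemma exists_quarticChar {p : ℕ} [hp : Fact p.Prime] (h : p % 4 = 1) :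
    ∃ χ : MulChar (ZMod p) ℤ[i], χ ^ 4 = 1 ∧ χ ^ 2 ≠ 1 ∧
      ∀ (a : (ZMod p)ˣ) (ε : ℤ), ε = 1 ∨ ε = -1 → (a : ZMod p) ^ ((p - 1) / 4) = ε → χ a = ε := by
  obtain ⟨g, hg⟩ := IsCyclic.exists_generator (α := (ZMod p)ˣ)
  have hcard : Fintype.card (ZMod p)ˣ = 4 * ((p - 1) / 4) := by
    rw [ZMod.card_units]; omega
  have hpos : 0 < (p - 1) / 4 := by have := hp.1.two_le; omega
  have hord : orderOf g = 4 * ((p - 1) / 4) := by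
    rw [orderOf_eq_card_of_forall_mem_zpowers hg, Nat.card_eq_fintype_card, hcard]
  set m := (p - 1) / 4
  let i : (ℤ[i])ˣ := ⟨⟨0, 1⟩, ⟨0, -1⟩, by decide, by decide⟩
  have hi2 : (i : ℤ[i]) ^ 2 = -1 := by decide
  have hi4 : (i : ℤ[i]) ^ 4 = 1 := by decide
  have hi : i ∈ rootsOfUnity (Fintype.card (ZMod p)ˣ) ℤ[i] := by
    rw [mem_rootsOfUnity, hcard, pow_mul]
    have : i ^ 4 = 1 := by ext1; simpa using hi4
    rw [this, one_pow]
  set χ := MulChar.ofRootOfUnity hi hg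
  have hχg : χ g = i := MulChar.ofRootOfUnity_spec hi hg
  have hp1 : (1 : ZMod p) ≠ -1 := by
    have : Fact (2 < p) := ⟨by have := hp.1.two_le; omega⟩
    exact (ZMod.neg_one_ne_one).symm
  refine ⟨χ, ?_, ?_, ?_⟩
  · rw [MulChar.eq_iff hg, MulChar.pow_apply_coe, hχg, hi4, MulChar.one_apply_coe]
  · rw [Ne, MulChar.eq_iff hg, MulChar.pow_apply_coe, hχg, hi2, MulChar.one_apply_coe]
    decide
  · intro a ε hε ha
    obtain ⟨k, rfl⟩ := mem_powers_iff_mem_zpowers.2 (hg a)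
    dsimp only at ha ⊢
    have hone : ∀ n : ℕ, ((g : ZMod p) ^ n = 1) → 4 * m ∣ n := fun n hn ↦ by
      rw [← hord]
      exact orderOf_dvd_of_pow_eq_one (by ext1; simpa using hn)
    rw [Units.val_pow_eq_pow_val] at ha ⊢
    rw [map_pow, hχg]
    rw [← pow_mul] at ha
    have h2 : 2 ∣ k := by
      have h1 : (g : ZMod p) ^ (k * m * 2) = 1 := by
        rw [pow_mul, ha]
        rcases hε with rfl | rfl <;> simp
      have h2 := hone _ h1
      rw [show 4 * m = m * 4 by ring, show k * m * 2 = m * (k * 2) by ring,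
        Nat.mul_dvd_mul_iff_left hpos] at h2
      omega
    obtain ⟨j, rfl⟩ := h2
    rw [pow_mul, hi2]
    rcases hε with rfl | rfl
    · have h2 := hone _ (by simpa using ha)
      rw [show 4 * m = m * 4 by ring, show 2 * j * m = m * (2 * j) by ring,
        Nat.mul_dvd_mul_iff_left hpos] at h2
      rw [Even.neg_one_pow (by rw [Nat.even_iff]; omega)]
      simp
    · have hodd : Odd j := by
        rw [← Nat.not_even_iff_odd]
        rintro ⟨l, rfl⟩
        rw [show 2 * (l + l) * m = 4 * m * l by ring, ← hord, pow_mul,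
          ← Units.val_pow_eq_pow_val, pow_orderOf_eq_one] at ha
        simp at ha
        exact hp1 ha
      rw [hodd.neg_one_pow]
      simp

lemma norm_jacobiSum {p : ℕ} [hp : Fact p.Prime] {χ : MulChar (ZMod p) ℤ[i]} (h2 : χ ^ 2 ≠ 1) :
    (jacobiSum χ χ).norm = p := by
  have h1 : χ ≠ 1 := fun h ↦ h2 (by rw [h, one_pow])
  have hinj := toComplex_injective
  have hchar : ringChar ℂ ≠ ringChar (ZMod p) := by
    rw [ringChar.eq_zero, ZMod.ringChar_zmod_n]
    exact hp.1.ne_zero.symm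
  have h := jacobiSum_mul_jacobiSum_inv hchar ((MulChar.ringHomComp_ne_one_iff hinj).2 h1)
    ((MulChar.ringHomComp_ne_one_iff hinj).2 h1)
    (by rw [← MulChar.ringHomComp_mul, ← pow_two]; exact (MulChar.ringHomComp_ne_one_iff hinj).2 h2)
  have hstar : jacobiSum (χ.ringHomComp toComplex)⁻¹ (χ.ringHomComp toComplex)⁻¹ =
      star (jacobiSum (χ.ringHomComp toComplex) (χ.ringHomComp toComplex)) := by
    simp only [jacobiSum, star_sum, star_mul', MulChar.star_apply']
  rw [hstar, jacobiSum_ringHomComp, ZMod.card, RCLike.star_def, Complex.mul_conj,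
    ← intCast_complex_norm] at h
  exact_mod_cast h

/-- In characteristic three, the square of the Jacobi sum `J(χ, χ)` of a quartic character
of `ZMod p` is `χ (-3)`, provided that `p ≡ 1 (mod 3)`. -/
lemma jacobiSum_sq_of_charP_three {p : ℕ} [hp : Fact p.Prime] (h : p % 3 = 1) {k : Type*} [Field k]
    [CharP k 3] {χ : MulChar (ZMod p) k} (h4 : χ ^ 4 = 1) (h2 : χ ^ 2 ≠ 1)
    {ψ : AddChar (ZMod p) k} (hψ : ψ.IsPrimitive) : jacobiSum χ χ ^ 2 = χ (-3) := by
  have : Fact (Nat.Prime 3) := ⟨Nat.prime_three⟩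
  have h1 : χ ≠ 1 := fun h ↦ h2 (by rw [h, one_pow])
  have hpk : (Fintype.card (ZMod p) : k) = 1 := by
    rw [ZMod.card, ← Nat.div_add_mod p 3, h]
    push_cast
    rw [show (3 : k) = ((3 : ℕ) : k) by norm_num, CharP.cast_eq_zero]
    ring
  have h3 : IsUnit (-3 : ZMod p) := by
    rw [isUnit_iff_ne_zero, neg_ne_zero, show (3 : ZMod p) = ((3 : ℕ) : ZMod p) by norm_num,
      Ne, ZMod.natCast_eq_zero_iff, Nat.prime_dvd_prime_iff_eq hp.1 Nat.prime_three]
    rintro rfl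
    simp at h
  have hinv : χ ^ 3 = χ⁻¹ := eq_inv_of_mul_eq_one_left (by rw [← pow_succ, h4])
  have hquad : (χ ^ 2).IsQuadratic := by
    intro a
    have : ((χ ^ 2) a) ^ 2 = 0 ∨ ((χ ^ 2) a) ^ 2 = 1 := by
      rw [← MulChar.pow_apply' _ two_ne_zero, ← pow_mul, h4]
      by_cases ha : IsUnit a
      · exact Or.inr (MulChar.one_apply ha)
      · exact Or.inl (MulChar.map_nonunit _ ha)
    rcases this with h | h
    · exact Or.inl (by simpa using h)
    · exact Or.inr (sq_eq_one_iff.1 h)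
  have hsq : gaussSum (χ ^ 2) ψ ^ 2 = 1 := by
    rw [gaussSum_sq h2 hquad hψ, hpk, mul_one, MulChar.pow_apply' _ two_ne_zero, ← map_pow]
    simp
  have hJ := jacobiSum_mul_nontrivial (χ := χ) (φ := χ) (by rwa [← pow_two]) ψ
  rw [← pow_two, ← pow_two] at hJ
  have hfrob := gaussSum_frob 3 χ ψ
  have hψ3 : ψ ^ 3 = AddChar.mulShift ψ⁻¹ (-3) := by
    rw [AddChar.pow_mulShift, AddChar.inv_mulShift, AddChar.mulShift_mulShift]
    norm_num
  have hshift := gaussSum_mulShift χ⁻¹ ψ⁻¹ h3.unit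
  rw [h3.unit_spec, ← hψ3, ← hinv, ← hfrob, hinv] at hshift
  have hcard := gaussSum_mul_gaussSum_eq_card h1 hψ
  rw [← hshift, hpk] at hcard
  have hJ2 : jacobiSum χ χ ^ 2 = gaussSum χ ψ * gaussSum χ ψ ^ 3 := by
    calc jacobiSum χ χ ^ 2 = (gaussSum (χ ^ 2) ψ * jacobiSum χ χ) ^ 2 := by
          rw [mul_pow, hsq, one_mul]
      _ = _ := by rw [hJ]; ring
  have hχ : χ (-3) * χ⁻¹ (-3) = 1 := by
    rw [← MulChar.mul_apply, mul_inv_cancel, MulChar.one_apply h3]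
  rw [hJ2]
  linear_combination χ (-3) * hcard - gaussSum χ ψ * gaussSum χ ψ ^ 3 * hχ

lemma modThreeChar_eq_of_map_sq {k : Type*} [Field k] [CharP k 3] (f : ℤ[i] →+* k) {z : ℤ[i]}
    (hz : z.norm % 3 = 1) {ε : ℤ} (hε : ε = 1 ∨ ε = -1) (h : f z ^ 2 = ε) :
    modThreeChar z = ε := by
  have hfz : f z ^ 2 = (z.re : k) ^ 2 - (z.im : k) ^ 2 + 2 * z.re * z.im * f ⟨0, 1⟩ := by
    have h1 : z = (z.re : ℤ[i]) + z.im * ⟨0, 1⟩ := by ext <;> simp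
    have h2 : f ⟨0, 1⟩ ^ 2 = -1 := by
      rw [← map_pow, show (⟨0, 1⟩ : ℤ[i]) ^ 2 = -1 by decide, map_neg, map_one]
    have h3 : f z = z.re + z.im * f ⟨0, 1⟩ := by
      conv_lhs => rw [h1]
      rw [map_add, map_mul, map_intCast, map_intCast]
    rw [h3]
    linear_combination (z.im : k) ^ 2 * h2
  have hcast : ∀ n : ℤ, (n : k) = 0 ↔ (3 : ℤ) ∣ n := fun n ↦ CharP.intCast_eq_zero_iff k 3 n
  have hsq : ∀ n : ℤ, n ^ 2 % 3 = if n % 3 = 0 then 0 else 1 := fun n ↦ by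
    rw [pow_two, Int.mul_emod]
    have : n % 3 = 0 ∨ n % 3 = 1 ∨ n % 3 = 2 := by omega
    rcases this with h | h | h <;> rw [h] <;> rfl
  have hre := hsq z.re
  have him := hsq z.im
  rw [norm_eq_sq_add_sq] at hz
  by_cases h1 : z.im % 3 = 0
  · have h2 : z.re % 3 ≠ 0 := by
      intro h2
      rw [if_pos h2] at hre
      rw [if_pos h1] at him
      omega
    rw [if_neg h2] at hre
    have h3 : ((z.re ^ 2 - ε : ℤ) : k) = 0 := by
      have := (hcast z.im).2 (by omega)
      rw [hfz, this] at h
      push_cast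
      linear_combination h
    rw [hcast] at h3
    rw [modThreeChar_eq_one h2 h1]
    rcases hε with rfl | rfl
    · simp
    · omega
  · have h2 : z.re % 3 = 0 := by
      by_contra h2
      rw [if_neg h2] at hre
      rw [if_neg h1] at him
      omega
    rw [if_neg h1] at him
    have h3 : ((-z.im ^ 2 - ε : ℤ) : k) = 0 := by
      have := (hcast z.re).2 (by omega)
      rw [hfz, this] at h
      push_cast
      linear_combination h
    rw [hcast] at h3
    rw [modThreeChar_eq_neg_one h2 h1]
    rcases hε with rfl | rfl
    · omega
    · simp

lemma nonempty_ringHom_charP_three : Nonempty (ℤ[i] →+* AlgebraicClosure (ZMod 3)) := by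
  obtain ⟨i, hi⟩ := IsAlgClosed.exists_pow_nat_eq (-1 : AlgebraicClosure (ZMod 3)) two_pos
  exact ⟨Zsqrtd.lift ⟨i, by rw [← pow_two, hi]; simp⟩⟩

/-- A prime `p ≡ 1 (mod 12)` is the norm of a primary Gaussian integer whose residue modulo `3`
is determined by the quartic residue character of `-3` modulo `p`. -/
lemma exists_isPrimary_modThreeChar_eq {p : ℕ} [hp : Fact p.Prime] (h : p % 12 = 1) {ε : ℤ}
    (hε : ε = 1 ∨ ε = -1) (hd : (p : ℤ) ∣ (-3) ^ ((p - 1) / 4) - ε) :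
    ∃ π : ℤ[i], IsPrimary π ∧ π.norm = p ∧ modThreeChar π = ε := by
  have : Fact (Nat.Prime 3) := ⟨Nat.prime_three⟩
  obtain ⟨χ, h4, h2, hχ⟩ := exists_quarticChar (p := p) (by omega)
  have h3 : (-3 : ZMod p) ≠ 0 := by
    rw [neg_ne_zero, show (3 : ZMod p) = ((3 : ℕ) : ZMod p) by norm_num,
      Ne, ZMod.natCast_eq_zero_iff, Nat.prime_dvd_prime_iff_eq hp.1 Nat.prime_three]
    rintro rfl
    simp at h
  have hχ3 : χ (-3) = ε := by
    refine hχ (Units.mk0 _ h3) ε hε ?_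
    have := (ZMod.intCast_zmod_eq_zero_iff_dvd _ p).2 hd
    push_cast at this
    rw [Units.val_mk0]
    exact sub_eq_zero.1 this
  set J := jacobiSum χ χ with hJ
  have hn : J.norm = p := norm_jacobiSum h2
  have hJχ : modThreeChar J = ε := by
    obtain ⟨f₀⟩ := nonempty_ringHom_charP_three
    have hchar : ringChar (AlgebraicClosure (ZMod 3)) ≠ ringChar (ZMod p) := by
      rw [ringChar.eq (AlgebraicClosure (ZMod 3)) 3, ZMod.ringChar_zmod_n]
      rintro rfl
      simp at h
    let ψ := AddChar.FiniteField.primitiveChar (ZMod p) (AlgebraicClosure (ZMod 3)) hchar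
    let K := CyclotomicField ψ.n (AlgebraicClosure (ZMod 3))
    have : CharP K 3 := charP_of_injective_algebraMap
      (algebraMap (AlgebraicClosure (ZMod 3)) K).injective 3
    let f : ℤ[i] →+* K := (algebraMap (AlgebraicClosure (ZMod 3)) K).comp f₀
    have hsq := jacobiSum_sq_of_charP_three (p := p) (k := K) (by omega)
      (χ := χ.ringHomComp f) ?_ ?_ ψ.prim
    · rw [jacobiSum_ringHomComp, MulChar.ringHomComp_apply, hχ3, map_intCast] at hsq
      exact modThreeChar_eq_of_map_sq f (by rw [hn]; omega) hε hsq
    · rw [MulChar.ringHomComp_pow, h4, MulChar.ringHomComp_one]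
    · intro hf
      refine h2 (MulChar.ext fun a ↦ ?_)
      have h1 : (χ ^ 2) a ^ 2 = 1 := by
        rw [← MulChar.pow_apply_coe, ← pow_mul, h4, MulChar.one_apply_coe]
      rw [MulChar.one_apply_coe]
      refine (sq_eq_one_iff.1 h1).resolve_right fun h5 ↦ ?_
      have h6 : ((χ ^ 2).ringHomComp f) a = 1 := by
        rw [← MulChar.ringHomComp_pow, hf, MulChar.one_apply_coe]
      rw [MulChar.ringHomComp_apply, h5, map_neg, map_one] at h6
      have h7 : ringChar K ≠ 2 := by rw [ringChar.eq K 3]; norm_num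
      exact Ring.neg_one_ne_one_of_char_ne_two h7 h6
  obtain ⟨z, -, hz⟩ := exists_jacobiSum_eq_neg_one_add (n := 4) (by norm_num) h4 h4
    (by rw [ZMod.card]; omega) (μ := (⟨0, 1⟩ : ℤ[i])) (by
      refine IsPrimitiveRoot.mk_of_lt _ (by norm_num) (by decide) ?_
      intro l h0 h4
      interval_cases l <;> decide)
  rw [← hJ] at hz
  have hz' : (⟨0, 1⟩ - 1 : ℤ[i]) ^ 2 = ⟨0, -2⟩ := by decide
  rw [hz'] at hz
  have hre := congrArg Zsqrtd.re hz
  have him := congrArg Zsqrtd.im hz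
  simp at hre him
  by_cases hP : IsPrimary J
  · exact ⟨J, hP, hn, hJχ⟩
  · refine ⟨-J, ?_, by rw [Zsqrtd.norm_neg, hn], ?_⟩
    · unfold IsPrimary at *
      rw [Zsqrtd.im_neg, Zsqrtd.re_neg]
      omega
    · have h1 : modThreeChar (-1) = 1 := by decide
      rw [← hJχ, ← one_mul (modThreeChar J), ← h1, ← map_mul, neg_one_mul]

/-- For `p ≡ 1 (mod 12)`, the residue `-3` is a square modulo `p`, so its quartic residue
character is `±1`. -/
lemma dvd_neg_three_pow_sub_one_or {p : ℕ} [hp : Fact p.Prime] (h : p % 12 = 1) :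
    (p : ℤ) ∣ (-3) ^ ((p - 1) / 4) - 1 ∨ (p : ℤ) ∣ (-3) ^ ((p - 1) / 4) + 1 := by
  have : Fact (Nat.Prime 3) := ⟨Nat.prime_three⟩
  obtain ⟨w, hw⟩ := exists_prime_orderOf_dvd_card (G := (ZMod p)ˣ) 3
    (by rw [ZMod.card_units]; omega)
  have hw1 : (w : ZMod p) - 1 ≠ 0 := by
    intro h
    have : w = 1 := by ext1; simpa [sub_eq_zero] using h
    rw [this, orderOf_one] at hw
    norm_num at hw
  have hw3 : (w : ZMod p) ^ 3 = 1 := by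
    rw [← Units.val_pow_eq_pow_val, ← hw, pow_orderOf_eq_one, Units.val_one]
  have hw2 : (w : ZMod p) ^ 2 + w + 1 = 0 := by
    refine (mul_eq_zero.1 (?_ : ((w : ZMod p) - 1) * _ = 0)).resolve_left hw1
    linear_combination hw3
  have hsq : (-3 : ZMod p) = (1 + 2 * w) ^ 2 := by linear_combination -4 * hw2
  have h0 : (1 + 2 * w : ZMod p) ≠ 0 := by
    intro h0
    rw [h0] at hsq
    have h3 : ((3 : ℕ) : ZMod p) = 0 := by push_cast; linear_combination -hsq
    rw [ZMod.natCast_eq_zero_iff, Nat.prime_dvd_prime_iff_eq hp.1 Nat.prime_three] at h3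
    subst h3
    simp at h
  have key : ((-3 : ZMod p) ^ ((p - 1) / 4)) ^ 2 = 1 := by
    rw [hsq, ← pow_mul, ← pow_mul, show 2 * ((p - 1) / 4 * 2) = p - 1 by omega,
      ZMod.pow_card_sub_one_eq_one h0]
  rw [← ZMod.intCast_zmod_eq_zero_iff_dvd, ← ZMod.intCast_zmod_eq_zero_iff_dvd]
  push_cast
  rw [sub_eq_zero, ← eq_neg_iff_add_eq_zero]
  exact sq_eq_one_iff.1 key

lemma intCast_eq_primarySum (f : ℕ → ℤ)
    (hf1 : f 1 = 1)
    (hfmul : ∀ m n : ℕ, Nat.Coprime m n → f (m * n) = f m * f n)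
    (hfa : ∀ p r : ℕ, p.Prime → 1 ≤ r → (p % 12 = 7 ∨ p % 12 = 11) → Even r →
      f (p ^ r) = 1)
    (hfb : ∀ p r : ℕ, p.Prime → 1 ≤ r → p % 12 = 5 → Even r →
      f (p ^ r) = (-1) ^ (r / 2))
    (hfc : ∀ p r : ℕ, p.Prime → 1 ≤ r → p % 12 = 1 →
      (p : ℤ) ∣ ((-3) ^ ((p - 1) / 4) - 1) →
      f (p ^ r) = r + 1)
    (hfd : ∀ p r : ℕ, p.Prime → 1 ≤ r → p % 12 = 1 →
      (p : ℤ) ∣ ((-3) ^ ((p - 1) / 4) + 1) →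
      f (p ^ r) = (-1) ^ r * (r + 1))
    (hf0 : ∀ p r : ℕ, p.Prime → 1 ≤ r →
      ¬(((p % 12 = 5 ∨ p % 12 = 7 ∨ p % 12 = 11) ∧ Even r) ∨
        (p % 12 = 1 ∧ ((p : ℤ) ∣ ((-3) ^ ((p - 1) / 4) - 1) ∨
          (p : ℤ) ∣ ((-3) ^ ((p - 1) / 4) + 1)))) →
      f (p ^ r) = 0) {n : ℕ} (hn : n ≠ 0) :
    (f n : ℤ[i]) = primarySum modThreeChar n := by
  induction n using Nat.recOnPosPrimePosCoprime with
  | zero => exact absurd rfl hn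
  | one => rw [hf1, primarySum_one, Int.cast_one]
  | coprime a b ha hb hab iha ihb =>
    rw [hfmul a b hab, primarySum_mul _ hab, Int.cast_mul, iha (by omega), ihb (by omega)]
  | prime_pow p r hp hr =>
    have hp' : Fact p.Prime := ⟨hp⟩
    by_cases h2 : p = 2
    · subst h2
      rw [hf0 2 r hp hr (by norm_num), primarySum_even _ ((even_two).pow_of_ne_zero hr.ne'),
        Int.cast_zero]
    by_cases h3 : p = 3
    · subst h3
      rw [hf0 3 r hp hr (by norm_num), primarySum_three_pow hr.ne', Int.cast_zero]
    have h2' : p % 2 ≠ 0 := fun h ↦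
      h2 ((Nat.prime_dvd_prime_iff_eq Nat.prime_two hp).1 (Nat.dvd_of_mod_eq_zero h)).symm
    have h3' : p % 3 ≠ 0 := fun h ↦
      h3 ((Nat.prime_dvd_prime_iff_eq Nat.prime_three hp).1 (Nat.dvd_of_mod_eq_zero h)).symm
    have hcases : p % 12 = 1 ∨ p % 12 = 5 ∨ p % 12 = 7 ∨ p % 12 = 11 := by omega
    rcases hcases with h | h | h
    · rcases dvd_neg_three_pow_sub_one_or h with hd | hd
      · obtain ⟨π, hπ, hπn, hπε⟩ := exists_isPrimary_modThreeChar_eq h (Or.inl rfl) hd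
        rw [hfc p r hp hr h hd, primarySum_pow_of_mod_twelve_eq_one hp hπ hπn hπε, one_pow,
          one_mul]
      · obtain ⟨π, hπ, hπn, hπε⟩ :=
          exists_isPrimary_modThreeChar_eq h (Or.inr rfl) (by rwa [sub_neg_eq_add])
        rw [hfd p r hp hr h hd, primarySum_pow_of_mod_twelve_eq_one hp hπ hπn hπε]
    · rw [primarySum_pow_of_mod_twelve_eq_five h]
      split_ifs with he
      · rw [hfb p r hp hr h he]
        push_cast
        rfl
      · rw [hf0 p r hp hr (by simp [he, h]), Int.cast_zero]
    · rw [primarySum_pow_of_mod_four_eq_three (by omega) h3']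
      split_ifs with he
      · rw [hfa p r hp hr h he, Int.cast_one]
      · rw [hf0 p r hp hr (by rintro (h' | h'); exacts [he h'.2, by omega]), Int.cast_zero]

/-- The primary Gaussian integer attached to a pair of pentagonal numbers. -/
def ofPentagonalPair (x : ℤ × ℤ) : ℤ[i] :=
  if (x.1 + x.2) % 2 = 0 then
    if x.1 % 2 = 0 then ⟨1 - 3 * (x.1 + x.2), 3 * (x.2 - x.1)⟩
    else ⟨3 * (x.1 + x.2) - 1, 3 * (x.1 - x.2)⟩
  else
    if x.2 % 2 = 0 then ⟨3 * (x.1 - x.2), 1 - 3 * (x.1 + x.2)⟩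
    else ⟨3 * (x.2 - x.1), 3 * (x.1 + x.2) - 1⟩

lemma isPrimary_ofPentagonalPair (x : ℤ × ℤ) : IsPrimary (ofPentagonalPair x) := by
  unfold ofPentagonalPair IsPrimary
  split_ifs <;> dsimp only <;> omega

lemma norm_ofPentagonalPair (x : ℤ × ℤ) :
    (ofPentagonalPair x).norm = 12 * (pentagonal x.1 + pentagonal x.2 : ℤ) + 1 := by
  have h1 := two_mul_natCast_pentagonal x.1
  have h2 := two_mul_natCast_pentagonal x.2
  rw [norm_eq_sq_add_sq]
  unfold ofPentagonalPair
  split_ifs <;> dsimp only <;> linear_combination -6 * h1 - 6 * h2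

lemma modThreeChar_ofPentagonalPair (x : ℤ × ℤ) :
    modThreeChar (ofPentagonalPair x) = ((Int.negOnePow (x.1 + x.2) : ℤ) : ℤ[i]) := by
  by_cases h : (x.1 + x.2) % 2 = 0
  · rw [Int.negOnePow_even _ (Int.even_iff.2 h), modThreeChar_eq_one]
    · simp
    all_goals
      unfold ofPentagonalPair
      split_ifs <;> dsimp only <;> omega
  · rw [Int.negOnePow_odd _ (Int.odd_iff.2 (by omega)), modThreeChar_eq_neg_one]
    · simp
    all_goals
      unfold ofPentagonalPair
      split_ifs <;> dsimp only <;> omega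

lemma ofPentagonalPair_injective : Function.Injective ofPentagonalPair := by
  rintro ⟨k, l⟩ ⟨k', l'⟩ h
  rw [Zsqrtd.ext_iff] at h
  unfold ofPentagonalPair at h
  rw [Prod.mk.injEq]
  split_ifs at h <;> dsimp only at * <;> omega

lemma exists_ofPentagonalPair_eq {z : ℤ[i]} (hz : IsPrimary z) (hn : z.norm % 3 = 1) :
    ∃ x, ofPentagonalPair x = z := by
  rw [norm_eq_sq_add_sq] at hn
  have hsq : ∀ n : ℤ, n ^ 2 % 3 = if n % 3 = 0 then 0 else 1 := fun n ↦ by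
    rw [pow_two, Int.mul_emod]
    have : n % 3 = 0 ∨ n % 3 = 1 ∨ n % 3 = 2 := by omega
    rcases this with h | h | h <;> rw [h] <;> rfl
  have hre := hsq z.re
  have him := hsq z.im
  obtain ⟨x, y⟩ := z
  unfold IsPrimary at hz
  dsimp only at *
  have key : ∀ k l : ℤ, (ofPentagonalPair (k, l)).re = x → (ofPentagonalPair (k, l)).im = y →
      ∃ u, ofPentagonalPair u = ⟨x, y⟩ := fun k l h1 h2 ↦ ⟨(k, l), Zsqrtd.ext h1 h2⟩
  have hcases : (x % 3 = 1 ∧ y % 3 = 0) ∨ (x % 3 = 2 ∧ y % 3 = 0) ∨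
      (x % 3 = 0 ∧ y % 3 = 1) ∨ (x % 3 = 0 ∧ y % 3 = 2) := by
    split_ifs at hre him <;> omega
  rcases hcases with h | h | h | h
  · apply key ((1 - x - y) / 6) ((1 - x + y) / 6) <;> unfold ofPentagonalPair <;>
      split_ifs <;> dsimp only at * <;> omega
  · apply key ((1 + x + y) / 6) ((1 + x - y) / 6) <;> unfold ofPentagonalPair <;>
      split_ifs <;> dsimp only at * <;> omega
  · apply key ((1 - y + x) / 6) ((1 - y - x) / 6) <;> unfold ofPentagonalPair <;>
      split_ifs <;> dsimp only at * <;> omega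
  · apply key ((1 + y - x) / 6) ((1 + y + x) / 6) <;> unfold ofPentagonalPair <;>
      split_ifs <;> dsimp only at * <;> omega

lemma coeff_pentagonalSeries_sq (n : ℕ) :
    (((PowerSeries.pentagonalSeries ℤ ^ 2).coeff n : ℤ) : ℤ[i]) =
      primarySum modThreeChar (12 * n + 1) := by
  have hinj : Function.Injective (Prod.map pentagonal pentagonal) :=
    pentagonal_injective.prodMap pentagonal_injective
  rw [pow_two, PowerSeries.coeff_mul,
    ← sum_preimage (Prod.map pentagonal pentagonal) (antidiagonal n) hinj.injOn, primarySum,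
    Int.cast_sum]
  · refine sum_bij (fun x _ ↦ ofPentagonalPair x) ?_ ?_ ?_ ?_
    · intro x hx
      rw [mem_preimage, HasAntidiagonal.mem_antidiagonal] at hx
      rw [mem_primaryOfNorm, norm_ofPentagonalPair, ← hx]
      exact ⟨isPrimary_ofPentagonalPair x, by simp⟩
    · exact fun _ _ _ _ h ↦ ofPentagonalPair_injective h
    · intro z hz
      rw [mem_primaryOfNorm] at hz
      obtain ⟨x, rfl⟩ := exists_ofPentagonalPair_eq hz.1 (by rw [hz.2]; omega)
      refine ⟨x, ?_, rfl⟩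
      rw [mem_preimage, HasAntidiagonal.mem_antidiagonal]
      have := hz.2
      rw [norm_ofPentagonalPair] at this
      dsimp only [Prod.map]
      omega
    · intro x _
      rw [modThreeChar_ofPentagonalPair, Int.negOnePow_add]
      simp [PowerSeries.coeff_pentagonalSeries_pentagonal]
  · rintro ⟨i, j⟩ - h
    by_cases hi : i ∈ Set.range pentagonal
    · rw [PowerSeries.coeff_pentagonalSeries_eq_zero ℤ (n := j), mul_zero]
      rintro ⟨l, rfl⟩
      obtain ⟨k, rfl⟩ := hi
      exact h ⟨(k, l), rfl⟩
    · rw [PowerSeries.coeff_pentagonalSeries_eq_zero ℤ hi, zero_mul]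

end GaussianInt

open PowerSeries in
lemma exists_coeff_prod_one_sub_X_pow_sq_eq (n : ℕ) :
    ∃ N ≥ n, ((∏ m ∈ Finset.Icc 1 N, ((1 : Polynomial ℤ) - Polynomial.X ^ m)) ^ 2).coeff n =
      (pentagonalSeries ℤ ^ 2).coeff n := by
  have h : ∀ᶠ s : Finset ℕ in Filter.atTop, ∀ i ∈ Finset.range (n + 1),
      (∏ m ∈ s, (1 - X ^ (m + 1) : ℤ⟦X⟧)).coeff i = (pentagonalSeries ℤ).coeff i :=
    (Filter.eventually_all_finset _).2 fun i _ ↦ coeff_prod_one_sub_X_pow_eventually_eq ℤ i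
  obtain ⟨s, hs⟩ := Filter.eventually_atTop.1 h
  obtain ⟨M, hM⟩ := s.exists_nat_subset_range
  refine ⟨max n M, le_max_left _ _, ?_⟩
  have hs := hs (Finset.range (max n M))
    (hM.trans (Finset.range_subset_range.2 (le_max_right _ _)))
  have hprod : ∀ N, ((∏ m ∈ Finset.Icc 1 N, ((1 : Polynomial ℤ) - Polynomial.X ^ m) :
      Polynomial ℤ) : ℤ⟦X⟧) = ∏ m ∈ Finset.range N, (1 - X ^ (m + 1)) := fun N ↦ by
    induction N with
    | zero => simp
    | succ N ih => rw [Finset.prod_Icc_succ_top (by omega), Finset.prod_range_succ, ← ih]; simp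
  rw [← Polynomial.coeff_coe, Polynomial.coe_pow, hprod, pow_two, pow_two, coeff_mul, coeff_mul]
  refine Finset.sum_congr rfl fun x hx ↦ ?_
  rw [Finset.HasAntidiagonal.mem_antidiagonal] at hx
  rw [hs _ (Finset.mem_range.2 (by omega)), hs _ (Finset.mem_range.2 (by omega))]

/-- With `a n` the coefficient of `q^n` in `∏ (1 - q^m)^2`, and `f` the
multiplicative function with the stated values on prime powers, we have
`a n = f (12 n + 1)` for all `n`. -/
theorem stmt_3 (a : ℕ → ℤ)
    (ha : ∀ n N : ℕ, n ≤ N →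
      a n = (((∏ m ∈ Finset.Icc 1 N, ((1 : Polynomial ℤ) - Polynomial.X ^ m)) ^ 2).coeff n))
    (f : ℕ → ℤ)
    (hf1 : f 1 = 1)
    (hfmul : ∀ m n : ℕ, Nat.Coprime m n → f (m * n) = f m * f n)
    (hfa : ∀ p r : ℕ, p.Prime → 1 ≤ r → (p % 12 = 7 ∨ p % 12 = 11) → Even r →
      f (p ^ r) = 1)
    (hfb : ∀ p r : ℕ, p.Prime → 1 ≤ r → p % 12 = 5 → Even r →
      f (p ^ r) = (-1) ^ (r / 2))
    (hfc : ∀ p r : ℕ, p.Prime → 1 ≤ r → p % 12 = 1 →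
      (p : ℤ) ∣ ((-3) ^ ((p - 1) / 4) - 1) →
      f (p ^ r) = r + 1)
    (hfd : ∀ p r : ℕ, p.Prime → 1 ≤ r → p % 12 = 1 →
      (p : ℤ) ∣ ((-3) ^ ((p - 1) / 4) + 1) →
      f (p ^ r) = (-1) ^ r * (r + 1))
    (hf0 : ∀ p r : ℕ, p.Prime → 1 ≤ r →
      ¬(((p % 12 = 5 ∨ p % 12 = 7 ∨ p % 12 = 11) ∧ Even r) ∨
        (p % 12 = 1 ∧ ((p : ℤ) ∣ ((-3) ^ ((p - 1) / 4) - 1) ∨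
          (p : ℤ) ∣ ((-3) ^ ((p - 1) / 4) + 1)))) →
      f (p ^ r) = 0) :
    ∀ n : ℕ, a n = f (12 * n + 1) := by
  intro n
  obtain ⟨N, hN, h⟩ := exists_coeff_prod_one_sub_X_pow_sq_eq n
  rw [ha n N hN, h]
  apply Int.cast_injective (α := GaussianInt)
  rw [GaussianInt.coeff_pentagonalSeries_sq,
    GaussianInt.intCast_eq_primarySum f hf1 hfmul hfa hfb hfc hfd hf0 (Nat.succ_ne_zero _)]
end
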